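/- Let A be a commutative noetherian ring with dim A/𝔞 = 1 (or else dim A ≤ 2), let x = x_1,…,x_t ∈ 𝔞, and let M be an A-module with Supp_A M ⊆ V(𝔞). If Hom_A(A/𝔞, H^j(x,M)) and Ext_A^1(A/𝔞, H^j(x,M)) are finitely generated for j = 0, 1, then M is 𝔞-cofinite. -/

import Mathlib

open CategoryTheory Limits

noncomputable section

variable {A : Type} [CommRing A]

/-- The `i`-th term of the Koszul cochain complex `Hom_A(K_•(x), M)`. -/
abbrev KoszulCochain {t : ℕ} (x : Fin t → A) (M : Type) [AddCommGroup M] [Module A M]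
    (i : ℕ) : Type :=
  {s : Finset (Fin t) // s.card = i} → M

/-- The Koszul cochain differential. -/
def koszulD {t : ℕ} (x : Fin t → A) (M : Type) [AddCommGroup M] [Module A M] (i : ℕ) :
    KoszulCochain x M i →ₗ[A] KoszulCochain x M (i + 1) :=
  LinearMap.pi fun s => ∑ j ∈ s.1.attach,
    (((-1 : A) ^ ((s.1.filter (fun k => k < j.1)).card)) * x j.1) •
      (LinearMap.proj
        (⟨s.1.erase j.1, by simp [Finset.card_erase_of_mem j.2, s.2]⟩ :
          {s : Finset (Fin t) // s.card = i}) :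
        KoszulCochain x M i →ₗ[A] M)

/-- The boundaries in degree `i` of the Koszul cochain complex. -/
def koszulBoundary {t : ℕ} (x : Fin t → A) (M : Type) [AddCommGroup M] [Module A M] :
    (i : ℕ) → Submodule A (KoszulCochain x M i)
  | 0 => ⊥
  | j + 1 => LinearMap.range (koszulD x M j)

/-- The `i`-th Koszul cohomology `H^i(x, M)` of `M` with respect to `x`. -/
abbrev KoszulCohomology {t : ℕ} (x : Fin t → A) (M : Type) [AddCommGroup M] [Module A M]
    (i : ℕ) : Type :=
  LinearMap.ker (koszulD x M i) ⧸
    (koszulBoundary x M i).comap (LinearMap.ker (koszulD x M i)).subtype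

/-- `Ext_A^i(A/𝔞, M)` as an `A`-module. -/
abbrev extQuot (𝔞 : Ideal A) (M : Type) [AddCommGroup M] [Module A M] (i : ℕ) : Type :=
  ↥(((_root_.Ext A (ModuleCat A) i).obj
    (Opposite.op (ModuleCat.of A (A ⧸ 𝔞)))).obj (ModuleCat.of A M))

/-- `M` is an `𝔞`-cofinite `A`-module: `Supp M ⊆ V(𝔞)` and all `Ext_A^i(A/𝔞, M)`
are finitely generated. -/
def IsCofinite (𝔞 : Ideal A) (M : Type) [AddCommGroup M] [Module A M] : Prop :=
  Module.support A M ⊆ PrimeSpectrum.zeroLocus (𝔞 : Set A) ∧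
    ∀ i : ℕ, Module.Finite A (extQuot 𝔞 M i)


/-- Ext in the derived category sense. -/
abbrev EE (𝔞 : Ideal A) (N : Type) [AddCommGroup N] [Module A N] (i : ℕ) : Type :=
  Abelian.Ext (ModuleCat.of A (A ⧸ 𝔞)) (ModuleCat.of A N) i

def EF (𝔞 : Ideal A) (N : Type) [AddCommGroup N] [Module A N] (i : ℕ) : Prop :=
  Module.Finite A (EE 𝔞 N i)

section
variable (𝔞 : Ideal A) {N N' N'' : Type} [AddCommGroup N] [Module A N]
  [AddCommGroup N'] [Module A N'] [AddCommGroup N''] [Module A N'']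

/-- functoriality of Ext -/
def Emap (i : ℕ) (f : N →ₗ[A] N') : EE 𝔞 N i →ₗ[A] EE 𝔞 N' i :=
  (Abelian.Ext.mk₀ (ModuleCat.ofHom f)).postcompOfLinear A _ (add_zero i)

lemma Emap_apply (i : ℕ) (f : N →ₗ[A] N') (α : EE 𝔞 N i) :
    Emap 𝔞 i f α = α.comp (Abelian.Ext.mk₀ (ModuleCat.ofHom f)) (add_zero i) := rfl

lemma Emap_comp (i : ℕ) (f : N →ₗ[A] N') (g : N' →ₗ[A] N'') :
    Emap 𝔞 i (g ∘ₗ f) = Emap 𝔞 i g ∘ₗ Emap 𝔞 i f := by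
  ext α
  simp [Emap_apply, ModuleCat.ofHom_comp, ← Abelian.Ext.mk₀_comp_mk₀]

lemma Emap_id (i : ℕ) : Emap 𝔞 i (LinearMap.id : N →ₗ[A] N) = LinearMap.id := by
  ext α
  simp [Emap_apply]

lemma Emap_add (i : ℕ) (f g : N →ₗ[A] N') :
    Emap 𝔞 i (f + g) = Emap 𝔞 i f + Emap 𝔞 i g := by
  ext α
  simp [Emap_apply, ModuleCat.ofHom_add, Abelian.Ext.mk₀_add]

lemma Emap_smul (i : ℕ) (r : A) (f : N →ₗ[A] N') :
    Emap 𝔞 i (r • f) = r • Emap 𝔞 i f := by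
  ext α
  have : ModuleCat.ofHom (r • f) = r • ModuleCat.ofHom f := rfl
  simp [Emap_apply, this, Abelian.Ext.mk₀_smul]

def EmapL (i : ℕ) : (N →ₗ[A] N') →ₗ[A] (EE 𝔞 N i →ₗ[A] EE 𝔞 N' i) where
  toFun := Emap 𝔞 i
  map_add' := Emap_add 𝔞 i
  map_smul' := Emap_smul 𝔞 i

lemma EE_smul_zero (i : ℕ) (y : A) (hy : y ∈ 𝔞) (α : EE 𝔞 N i) : y • α = 0 := by
  have h : α = (Abelian.Ext.mk₀ (𝟙 _)).comp α (zero_add i) := by simp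
  rw [h, ← Abelian.Ext.smul_comp, ← Abelian.Ext.mk₀_smul]
  have : y • 𝟙 (ModuleCat.of A (A ⧸ 𝔞)) = 0 := by
    ext
    simp [Algebra.smul_def, Ideal.Quotient.eq_zero_iff_mem.mpr hy]
  rw [this]; simp

lemma Emap_smul_zero (i : ℕ) (y : A) (hy : y ∈ 𝔞) (f : N →ₗ[A] N') :
    Emap 𝔞 i (y • f) = 0 := by
  rw [Emap_smul]; ext α
  simp [EE_smul_zero 𝔞 i y hy]

lemma ses {f : N →ₗ[A] N'} {g : N' →ₗ[A] N''} (hf : Function.Injective f)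
    (hg : Function.Surjective g) (h : Function.Exact f g) :
    (ShortComplex.mk (ModuleCat.ofHom f) (ModuleCat.ofHom g)
      (by ext x; exact (h _).2 ⟨x, rfl⟩)).ShortExact where
  exact := by
    rw [ShortComplex.moduleCat_exact_iff]
    intro x hx
    exact (h x).1 hx
  mono_f := (ModuleCat.mono_iff_injective _).2 hf
  epi_g := (ModuleCat.epi_iff_surjective _).2 hg

variable [IsNoetherianRing A]

lemma fin_of_exact {X Y Z : Type} [AddCommGroup X] [Module A X] [AddCommGroup Y] [Module A Y]
    [AddCommGroup Z] [Module A Z] (φ : X →ₗ[A] Y) (ψ : Y →ₗ[A] Z)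
    (h : ∀ y, ψ y = 0 → ∃ x, φ x = y) [Module.Finite A X] [Module.Finite A Z] :
    Module.Finite A Y := by
  have h1 : Module.Finite A (LinearMap.ker ψ) := by
    have : LinearMap.ker ψ = (LinearMap.range φ) ⊓ LinearMap.ker ψ := by
      refine le_antisymm (fun y hy => ⟨?_, hy⟩) inf_le_right
      obtain ⟨x, hx⟩ := h y hy
      exact ⟨x, hx⟩
    have h2 : IsNoetherian A (LinearMap.range φ) := inferInstance
    rw [this]
    exact Module.Finite.of_injective (Submodule.inclusion (inf_le_left :
      LinearMap.range φ ⊓ LinearMap.ker ψ ≤ _)) (Submodule.inclusion_injective _)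
  have h3 : Module.Finite A (LinearMap.range ψ) := inferInstance
  have h4 : Module.Finite A (Y ⧸ LinearMap.ker ψ) := Module.Finite.equiv
    ψ.quotKerEquivRange.symm
  exact Module.Finite.of_submodule_quotient (LinearMap.ker ψ)

lemma fin_ker_of_exact {X Y Z : Type} [AddCommGroup X] [Module A X] [AddCommGroup Y] [Module A Y]
    [AddCommGroup Z] [Module A Z] (φ : X →ₗ[A] Y) (ψ : Y →ₗ[A] Z)
    (h : ∀ y, ψ y = 0 → ∃ x, φ x = y) [Module.Finite A X]  :
    Module.Finite A (LinearMap.ker ψ) := by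
  have : LinearMap.ker ψ ≤ (LinearMap.range φ) := h
  exact Module.Finite.of_injective (Submodule.inclusion this) (Submodule.inclusion_injective _)

lemma fin_ker_comp {X Y Z : Type} [AddCommGroup X] [Module A X] [AddCommGroup Y] [Module A Y]
    [AddCommGroup Z] [Module A Z] (φ : X →ₗ[A] Y) (ψ : Y →ₗ[A] Z)
    (h1 : Module.Finite A (LinearMap.ker φ)) (h2 : Module.Finite A (LinearMap.ker ψ)) :
    Module.Finite A (LinearMap.ker (ψ ∘ₗ φ)) := by
  let φ' : LinearMap.ker (ψ ∘ₗ φ) →ₗ[A] LinearMap.ker ψ :=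
    φ.restrict (fun x hx => hx)
  let j : LinearMap.ker φ →ₗ[A] LinearMap.ker (ψ ∘ₗ φ) :=
    Submodule.inclusion (fun x hx => by simp_all)
  exact fin_of_exact j φ' (fun y hy => ⟨⟨y.1, congrArg Subtype.val hy⟩, rfl⟩)

lemma fin_of_ker_zero {X Y : Type} [AddCommGroup X] [Module A X] [AddCommGroup Y] [Module A Y]
    (φ : X →ₗ[A] Y) (h : φ = 0) (h1 : Module.Finite A (LinearMap.ker φ)) : Module.Finite A X := by
  subst h
  rw [LinearMap.ker_zero] at h1
  exact Module.Finite.equiv (Submodule.topEquiv (R := A) (M := X))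

variable {𝔞}
variable {f : N →ₗ[A] N'} {g : N' →ₗ[A] N''}

lemma EF_mid (hf : Function.Injective f)
    (hg : Function.Surjective g) (h : Function.Exact f g) {i : ℕ}
    (h1 : EF 𝔞 N i) (h3 : EF 𝔞 N'' i) : EF 𝔞 N' i := by
  unfold EF at *
  exact fin_of_exact (Emap 𝔞 i f) (Emap 𝔞 i g) (fun y hy =>
    Abelian.Ext.covariant_sequence_exact₂ _ (ses hf hg h) y hy)

lemma EF_right (hf : Function.Injective f)
    (hg : Function.Surjective g) (h : Function.Exact f g) {i : ℕ}
    (h2 : EF 𝔞 N' i) (h1 : EF 𝔞 N (i + 1)) : EF 𝔞 N'' i := by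
  unfold EF at *
  exact fin_of_exact (Emap 𝔞 i g) ((ses hf hg h).extClass.postcompOfLinear A _ rfl) (fun y hy =>
    Abelian.Ext.covariant_sequence_exact₃ _ (ses hf hg h) y rfl hy)

lemma EF_left (hf : Function.Injective f)
    (hg : Function.Surjective g) (h : Function.Exact f g) {i : ℕ}
    (h3 : EF 𝔞 N'' i) (h2 : EF 𝔞 N' (i + 1)) : EF 𝔞 N (i + 1) := by
  unfold EF at *
  exact fin_of_exact ((ses hf hg h).extClass.postcompOfLinear A _ rfl) (Emap 𝔞 (i + 1) f) (fun y hy =>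
    Abelian.Ext.covariant_sequence_exact₁ _ (ses hf hg h) y hy rfl)

lemma ker_surj (hg : Function.Surjective g) {i : ℕ} (h : EF 𝔞 (LinearMap.ker g) i) :
    Module.Finite A (LinearMap.ker (Emap 𝔞 i g)) := by
  unfold EF at h
  exact fin_ker_of_exact (Emap 𝔞 i (LinearMap.ker g).subtype) _ (fun y hy =>
    Abelian.Ext.covariant_sequence_exact₂ _ (ses (Submodule.subtype_injective _) hg
      (by intro x; simp)) y hy)

lemma ker_inj_zero (hf : Function.Injective f) : LinearMap.ker (Emap 𝔞 0 f) = ⊥ := by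
  rw [LinearMap.ker_eq_bot]
  have : Mono (ModuleCat.ofHom f) := (ModuleCat.mono_iff_injective _).2 hf
  exact Abelian.Ext.postcomp_mk₀_injective_of_mono _ (ModuleCat.ofHom f)

lemma ker_inj (hf : Function.Injective f) {i : ℕ} (h : EF 𝔞 (N' ⧸ LinearMap.range f) i) :
    Module.Finite A (LinearMap.ker (Emap 𝔞 (i + 1) f)) := by
  unfold EF at h
  have S := ses hf (Submodule.mkQ_surjective (LinearMap.range f))
      (by intro x; simp)
  exact fin_ker_of_exact (S.extClass.postcompOfLinear A _ rfl) _ (fun y hy =>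
    Abelian.Ext.covariant_sequence_exact₁ _ S y hy rfl)

lemma EF_inj_zero (hf : Function.Injective f) (h : EF 𝔞 N' 0) : EF 𝔞 N 0 := by
  unfold EF at *
  exact Module.Finite.of_injective (Emap 𝔞 0 f) (LinearMap.ker_eq_bot.1 (ker_inj_zero hf))

lemma EF_equiv (e : N ≃ₗ[A] N') {i : ℕ} (h : EF 𝔞 N i) : EF 𝔞 N' i := by
  unfold EF at *
  refine Module.Finite.of_surjective (Emap 𝔞 i e.toLinearMap) (fun y => ⟨Emap 𝔞 i e.symm.toLinearMap y, ?_⟩)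
  rw [← LinearMap.comp_apply, ← Emap_comp]
  have : e.toLinearMap ∘ₗ e.symm.toLinearMap = LinearMap.id := by ext; simp
  rw [this, Emap_id]; rfl

lemma EF_of_finite [Module.Finite A N] (i : ℕ) : EF 𝔞 N i := by
  unfold EF
  have : Module.Finite A (ModuleCat.of A N) := ‹_›
  have : Module.Finite A (ModuleCat.of A (A ⧸ 𝔞)) := inferInstanceAs (Module.Finite A (A ⧸ 𝔞))
  infer_instance

lemma EF_pi {ι : Type} [Finite ι] {i : ℕ} (h : EF 𝔞 N i) : EF 𝔞 (ι → N) i := by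
  classical
  have := Fintype.ofFinite ι
  unfold EF at *
  refine Module.Finite.of_injective
    (LinearMap.pi fun j : ι => Emap 𝔞 i (LinearMap.proj (R := A) (φ := fun _ : ι => N) j)) ?_
  rw [← LinearMap.ker_eq_bot, LinearMap.ker_eq_bot']
  intro α hα
  have h1 : (LinearMap.id : (ι → N) →ₗ[A] (ι → N)) =
      ∑ j, LinearMap.single A (fun _ : ι => N) j ∘ₗ LinearMap.proj j := by
    ext; simp
  have h2 : EmapL 𝔞 i (LinearMap.id : (ι → N) →ₗ[A] (ι → N)) α = α := by
    change Emap 𝔞 i _ α = α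
    rw [Emap_id]; rfl
  rw [← h2, h1, map_sum, LinearMap.sum_apply]
  refine Finset.sum_eq_zero fun j _ => ?_
  change Emap 𝔞 i _ α = 0
  rw [Emap_comp, LinearMap.comp_apply]
  have := congrFun hα j
  simp only [LinearMap.pi_apply, Pi.zero_apply] at this
  rw [this, map_zero]

end
lemma extMk_zero_iff0 {X Y : ModuleCat.{0} A} (P : ProjectiveResolution X)
    (f : P.complex.X 0 ⟶ Y) (hf : P.complex.d 1 0 ≫ f = 0) :
    P.extMk f 1 rfl hf = 0 ↔ f = 0 := by
  refine ⟨fun h => ?_, fun h => by subst h; simp⟩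
  rw [← P.extEquivCohomologyClass.apply_eq_iff_eq,
    P.extEquivCohomologyClass_extMk, P.extEquivCohomologyClass_zero,
    CochainComplex.HomComplex.CohomologyClass.mk_eq_zero_iff] at h
  rw [CochainComplex.HomComplex.Cocycle.toSingleMk_mem_coboundaries_iff _ _ _ _ _ 1 (by simp)] at h
  obtain ⟨g, hg⟩ := h
  have hz : IsZero (P.cochainComplex.X 1) := CochainComplex.isZero_of_isStrictlyLE _ 0 _
  rw [hz.eq_of_src g 0, comp_zero] at hg
  rw [← cancel_epi (P.cochainComplexXIso (-((0 : ℕ) : ℤ)) 0 rfl).hom, ← hg]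
  simp

lemma extMk_smul {X Y : ModuleCat.{0} A} (P : ProjectiveResolution X) {n : ℕ} (r : A)
    (f : P.complex.X n ⟶ Y) (hf : P.complex.d (n + 1) n ≫ f = 0) :
    r • P.extMk f (n + 1) rfl hf = P.extMk (r • f) (n + 1) rfl (by simp [hf]) := by
  rw [Abelian.Ext.smul_eq_comp_mk₀, P.extMk_comp_mk₀]
  congr 1

lemma cmp_aux {X Y : ModuleCat.{0} A} (P : ProjectiveResolution X) (n : ℕ) :
    Nonempty ((P.complex.linearYonedaObj A Y).homology n ≃ₗ[A] Abelian.Ext X Y n) := by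
  set K := P.complex.linearYonedaObj A Y
  obtain ⟨i, hi⟩ : ∃ i, (ComplexShape.up ℕ).prev n = i := ⟨_, rfl⟩
  have hk : (ComplexShape.up ℕ).next n = n + 1 := by simp
  let S := K.sc' i n (n + 1)
  let e1 : K.homology n ≅ S.homology := K.homologyIsoSc' i n (n + 1) hi hk
  let e2 := S.moduleCatHomologyIso
  have hmem : ∀ f : S.X₂, S.g.hom f = 0 → P.complex.d (n + 1) n ≫ (show P.complex.X n ⟶ Y from f) = 0 :=
    fun f hf => hf
  let φ : LinearMap.ker S.g.hom →ₗ[A] Abelian.Ext X Y n :=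
    { toFun := fun f => P.extMk (show P.complex.X n ⟶ Y from f.1) (n + 1) rfl (hmem f.1 f.2)
      map_add' := fun f g => (P.add_extMk _ _ _ _ _ _).symm
      map_smul' := fun r f => (extMk_smul P r (show P.complex.X n ⟶ Y from f.1) (hmem f.1 f.2)).symm }
  have hsurj : Function.Surjective φ := by
    intro α
    obtain ⟨f, hf, h⟩ := P.extMk_surjective α (n + 1) rfl
    exact ⟨⟨f, hf⟩, h⟩
  have hker : LinearMap.range S.moduleCatToCycles = LinearMap.ker φ := by
    ext f
    rw [LinearMap.mem_ker]
    change _ ↔ P.extMk (show P.complex.X n ⟶ Y from f.1) (n + 1) rfl (hmem f.1 f.2) = 0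
    rcases n with _ | n
    · rw [extMk_zero_iff0]
      obtain rfl : i = 0 := by rw [← hi]; simp
      constructor
      · rintro ⟨g, rfl⟩
        change P.complex.d 0 0 ≫ (show P.complex.X 0 ⟶ Y from g) = 0
        rw [P.complex.shape _ _ (by simp), zero_comp]
      · intro h
        have : f = 0 := Subtype.ext h
        rw [this]; exact zero_mem _
    · obtain rfl : i = n := by rw [← hi]; simp
      rw [P.extMk_eq_zero_iff _ _ _ _ i rfl]
      constructor
      · rintro ⟨g, rfl⟩
        exact ⟨g, rfl⟩
      · rintro ⟨g, hg⟩
        exact ⟨g, Subtype.ext hg⟩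
  exact ⟨(e1 ≪≫ e2).toLinearEquiv ≪≫ₗ (Submodule.quotEquivOfEq _ _ hker ≪≫ₗ
    φ.quotKerEquivOfSurjective hsurj)⟩

lemma extQuot_iff (𝔞 : Ideal A) (M : Type) [AddCommGroup M] [Module A M] (i : ℕ) :
    Module.Finite A (extQuot 𝔞 M i) ↔ EF 𝔞 M i := by
  let P := projectiveResolution (ModuleCat.of A (A ⧸ 𝔞))
  obtain ⟨e⟩ := cmp_aux (Y := ModuleCat.of A M) P i
  let e' := (P.isoExt (R := A) i (ModuleCat.of A M)).toLinearEquiv ≪≫ₗ e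
  exact ⟨fun h => Module.Finite.equiv e', fun h => by
    unfold EF at h
    exact Module.Finite.equiv e'.symm⟩

/-- elements of `N` killed by `I` -/
def kill {R : Type*} [CommRing R] (I : Ideal R) (N : Type*) [AddCommGroup N] [Module R N] :
    Submodule R N where
  carrier := {n | ∀ a ∈ I, a • n = 0}
  add_mem' := fun ha hb r hr => by rw [smul_add, ha r hr, hb r hr, add_zero]
  zero_mem' := fun r _ => smul_zero r
  smul_mem' := fun c n hn r hr => by rw [smul_comm, hn r hr, smul_zero]

lemma mem_kill {R : Type*} [CommRing R] {I : Ideal R} {N : Type*} [AddCommGroup N] [Module R N]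
    {n : N} : n ∈ kill I N ↔ ∀ a ∈ I, a • n = 0 := Iff.rfl

lemma EF_zero_iff {𝔞 : Ideal A} {N : Type} [AddCommGroup N] [Module A N] :
    EF 𝔞 N 0 ↔ Module.Finite A (kill 𝔞 N) := by
  let e0 : EE 𝔞 N 0 ≃ₗ[A] ((A ⧸ 𝔞) →ₗ[A] N) := Abelian.Ext.linearEquiv₀.trans ModuleCat.homLinearEquiv
  let e1 : ((A ⧸ 𝔞) →ₗ[A] N) →ₗ[A] kill 𝔞 N :=
    { toFun := fun f => ⟨f 1, fun a ha => by
        rw [← map_smul, Algebra.smul_def, Ideal.Quotient.algebraMap_eq,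
          Ideal.Quotient.eq_zero_iff_mem.mpr ha, zero_mul, map_zero]⟩
      map_add' := fun f g => rfl
      map_smul' := fun f g => rfl }
  have h1 : Function.Bijective e1 := by
    constructor
    · intro f g h
      have h' : f 1 = g 1 := congrArg Subtype.val h
      refine LinearMap.ext fun x => ?_
      obtain ⟨a, rfl⟩ := Ideal.Quotient.mk_surjective x
      have : Ideal.Quotient.mk 𝔞 a = a • (1 : A ⧸ 𝔞) := by simp [Algebra.smul_def]
      rw [this, map_smul, map_smul, h']
    · intro n
      refine ⟨Submodule.liftQ 𝔞 (LinearMap.toSpanSingleton A N n.1) ?_, ?_⟩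
      · intro a ha
        simpa using n.2 a ha
      · apply Subtype.ext
        change Submodule.liftQ 𝔞 (LinearMap.toSpanSingleton A N n.1) _ (Submodule.Quotient.mk 1) = n.1
        rw [Submodule.liftQ_apply]
        simp
  let e := e0 ≪≫ₗ LinearEquiv.ofBijective e1 h1
  exact ⟨fun h => by unfold EF at h; exact Module.Finite.equiv e, fun h => Module.Finite.equiv e.symm⟩

section
variable {R : Type} [CommRing R]

lemma kill_pow_finite [IsNoetherianRing R] {I : Ideal R} {N : Type} [AddCommGroup N] [Module R N]
    (h : Module.Finite R (kill I N)) (k : ℕ) : Module.Finite R (kill (I ^ k) N) := by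
  induction k with
  | zero =>
    have : kill (I ^ 0) N = ⊥ := by
      rw [eq_bot_iff]; intro n hn
      simpa using hn 1 (by simp)
    rw [this]; infer_instance
  | succ k ih =>
    obtain ⟨s, hs⟩ := (isNoetherianRing_iff_ideal_fg R).1 ‹_› I
    let φ : kill (I ^ (k + 1)) N →ₗ[R] ({y // y ∈ s} → kill (I ^ k) N) :=
      LinearMap.pi fun y => (LinearMap.lsmul R N y.1).restrict (fun n hn a ha => by
        rw [LinearMap.lsmul_apply, smul_smul]
        exact hn _ (pow_succ I k ▸ Ideal.mul_mem_mul ha (hs ▸ Ideal.subset_span y.2)))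
    have hle : I ^ (k + 1) ≤ I := Ideal.pow_le_self (by simp)
    let j : kill I N →ₗ[R] kill (I ^ (k + 1)) N :=
      Submodule.inclusion (fun n hn a ha => hn a (hle ha))
    refine fin_of_exact j φ (fun n hn => ?_)
    refine ⟨⟨n.1, fun a ha => ?_⟩, rfl⟩
    rw [← hs] at ha
    induction ha using Submodule.span_induction with
    | mem y hy => exact congrArg Subtype.val (congrFun hn ⟨y, hy⟩)
    | zero => simp
    | add a b _ _ ha hb => rw [add_smul, ha, hb, add_zero]
    | smul r a _ ha => rw [smul_assoc, ha, smul_zero]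

/-- single element case -/
lemma artin_single (x : R) {N : Type} [AddCommGroup N] [Module R N]
    (ht : ∀ n : N, ∃ k : ℕ, x ^ k • n = 0)
    (K : Submodule R N) (hK : ∀ n, x • n = 0 → n ∈ K) [IsArtinian R K] : IsArtinian R N := by
  rw [← monotone_stabilizes_iff_artinian]
  intro F
  have hF : ∀ {i j}, i ≤ j → OrderDual.ofDual (F j) ≤ OrderDual.ofDual (F i) := fun h => F.monotone h
  let G : ℕ → Submodule R N := fun i => OrderDual.ofDual (F i)
  have hG : ∀ {i j}, i ≤ j → G j ≤ G i := fun h => hF h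
  let D : ℕ → ℕ → Submodule R K := fun i n =>
    { carrier := {v | ∃ u ∈ G i, x ^ (n + 1) • u = 0 ∧ x ^ n • u = v.1}
      add_mem' := by
        rintro a b ⟨u, hu, h1, h2⟩ ⟨u', hu', h1', h2'⟩
        exact ⟨u + u', add_mem hu hu', by rw [smul_add, h1, h1', add_zero],
          by rw [smul_add, h2, h2']; rfl⟩
      zero_mem' := ⟨0, zero_mem _, by simp, by simp⟩
      smul_mem' := by
        rintro c a ⟨u, hu, h1, h2⟩
        exact ⟨c • u, Submodule.smul_mem _ _ hu, by rw [smul_comm, h1, smul_zero],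
          by rw [smul_comm, h2]; rfl⟩ }
  have Di : ∀ {i j} n, i ≤ j → D j n ≤ D i n := by
    rintro i j n h v ⟨u, hu, h1, h2⟩
    exact ⟨u, hG h hu, h1, h2⟩
  have Dn1 : ∀ i n, D i (n + 1) ≤ D i n := by
    rintro i n v ⟨u, hu, h1, h2⟩
    refine ⟨x • u, Submodule.smul_mem _ _ hu, ?_, ?_⟩
    · rw [smul_smul, ← pow_succ]; exact h1
    · rw [smul_smul, ← pow_succ]; exact h2
  have Dn : ∀ i {m n}, m ≤ n → D i n ≤ D i m := fun i => 
    fun {m n} h => antitone_nat_of_succ_le (Dn1 i) h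
  obtain ⟨_, ⟨⟨i0, n0⟩, rfl⟩, hmin⟩ := IsArtinian.set_has_minimal
    (Set.range fun p : ℕ × ℕ => D p.1 p.2) ⟨_, ⟨(0, 0), rfl⟩⟩
  have hmin' : ∀ i n, i0 ≤ i → n0 ≤ n → D i n = D i0 n0 := by
    intro i n hi hn
    by_contra hne
    exact hmin _ ⟨(i, n), rfl⟩ (lt_of_le_of_ne ((Di n hi).trans (Dn i0 hn)) hne)
  have hst : ∀ n, ∃ i1, ∀ i, i1 ≤ i → D i1 n = D i n := by
    intro n
    exact IsArtinian.monotone_stabilizes (R := R) (M := K)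
      ⟨fun i => OrderDual.toDual (D i n), fun i j h => Di n h⟩
  choose st hst using hst
  obtain ⟨B, hB⟩ : ∃ B, ∀ n < n0, st n ≤ B :=
    ⟨(Finset.range n0).sup st, fun n hn => Finset.le_sup (f := st) (Finset.mem_range.2 hn)⟩
  refine ⟨max i0 B, fun i hi => ?_⟩
  have key : ∀ n, D i n = D (max i0 B) n := by
    intro n
    by_cases hn : n0 ≤ n
    · rw [hmin' i n ((le_max_left _ _).trans hi) hn, hmin' _ n (le_max_left _ _) hn]
    · push Not at hn
      rw [← hst n i ((hB n hn).trans ((le_max_right _ _).trans hi)),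
        ← hst n _ ((hB n hn).trans (le_max_right _ _))]
  have hle : ∀ n, ∀ u ∈ G (max i0 B), x ^ n • u = 0 → u ∈ G i := by
    intro n
    induction n with
    | zero => intro u hu h; have : u = 0 := by simpa using h
              rw [this]; exact zero_mem _
    | succ n ih =>
      intro u hu h
      have hv : x ^ n • u ∈ K := hK _ (by rw [smul_smul, ← pow_succ']; exact h)
      have hv2 : (⟨x ^ n • u, hv⟩ : K) ∈ D i n := by
        rw [key]; exact ⟨u, hu, h, rfl⟩
      obtain ⟨u', hu', h1, h2⟩ := hv2
      have : u - u' ∈ G i := by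
        refine ih _ (sub_mem hu (hG hi hu')) ?_
        rw [smul_sub, h2]; simp
      simpa using add_mem this hu'
  apply le_antisymm (show F (max i0 B) ≤ F i from F.monotone hi)
  change G (max i0 B) ≤ G i
  intro u hu
  obtain ⟨k, hk⟩ := ht u
  exact hle k u hu hk

lemma artin_kill_aux (s : Finset R) : ∀ (N : Type) [AddCommGroup N] [Module R N]
    (ht : ∀ n : N, ∀ x ∈ s, ∃ k : ℕ, x ^ k • n = 0)
    (hK : IsArtinian R (kill (Ideal.span (s : Set R)) N)), IsArtinian R N := by
  classical
  induction s using Finset.induction_on with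
  | empty =>
    intro N _ _ ht hK
    have : kill (Ideal.span ((∅ : Finset R) : Set R)) N = ⊤ := by
      rw [eq_top_iff]; intro n _ a ha
      have : a = 0 := by simpa using ha
      rw [this, zero_smul]
    rw [this] at hK
    exact isArtinian_of_linearEquiv (Submodule.topEquiv (R := R) (M := N))
  | insert x s hx ih =>
    intro N _ _ ht hK
    let W := LinearMap.ker (LinearMap.lsmul R N x)
    have hW : ∀ n, n ∈ W ↔ x • n = 0 := fun n => Iff.rfl
    have : IsArtinian R W := by
      refine ih W (fun n y hy => ?_) ?_
      · obtain ⟨k, hk⟩ := ht n.1 y (Finset.mem_insert_of_mem hy)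
        exact ⟨k, Subtype.ext hk⟩
      · let j : kill (Ideal.span (s : Set R)) W →ₗ[R] kill (Ideal.span ((insert x s : Finset R) : Set R)) N :=
          (W.subtype).restrict (fun w hw a ha => by
            induction ha using Submodule.span_induction with
            | mem y hy =>
              rcases Finset.mem_insert.1 hy with rfl | hy
              · exact (hW _).1 w.2
              · exact congrArg Subtype.val (hw y (Ideal.subset_span hy))
            | zero => simp
            | add a b _ _ ha hb => rw [add_smul, ha, hb, add_zero]
            | smul r a _ ha => rw [smul_assoc, ha, smul_zero])
        refine isArtinian_of_injective j (fun a b h => ?_)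
        have := congrArg Subtype.val h
        exact Subtype.ext (Subtype.ext this)
    exact artin_single x (fun n => ht n x (Finset.mem_insert_self _ _)) W (fun n hn => hn)

/-- torsion modules -/
def Tors (I : Ideal R) (N : Type) [AddCommGroup N] [Module R N] : Prop :=
  ∀ n : N, ∀ x ∈ I, ∃ k : ℕ, x ^ k • n = 0

lemma artin_kill [IsNoetherianRing R] {I : Ideal R} {N : Type} [AddCommGroup N] [Module R N]
    (ht : Tors I N) (hK : IsArtinian R (kill I N)) : IsArtinian R N := by
  obtain ⟨s, hs⟩ := (isNoetherianRing_iff_ideal_fg R).1 ‹_› I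
  refine artin_kill_aux s N (fun n x hx => ht n x (hs ▸ Ideal.subset_span hx)) ?_
  rw [← hs] at hK; exact hK

lemma artin_of_ann [IsNoetherianRing R] {I : Ideal R} {N : Type} [AddCommGroup N] [Module R N]
    [Module.Finite R N] (h0 : ∀ a ∈ I, ∀ n : N, a • n = 0)
    (hI : ∀ q : Ideal R, q.IsPrime → I ≤ q → q.IsMaximal) : IsArtinian R N := by
  have : Ring.KrullDimLE 0 (R ⧸ I) := by
    rw [Ring.krullDimLE_zero_iff]
    intro q hq
    have h1 : (q.comap (Ideal.Quotient.mk I)).IsMaximal := hI _ (hq.comap _) (by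
      intro a ha
      rw [Ideal.mem_comap, Ideal.Quotient.eq_zero_iff_mem.mpr ha]; exact zero_mem _)
    rw [← Ideal.map_comap_of_surjective _ Ideal.Quotient.mk_surjective q]
    exact (Ideal.map_eq_top_or_isMaximal_of_surjective _ Ideal.Quotient.mk_surjective h1).resolve_left
      (fun h => hq.ne_top (by rwa [Ideal.map_comap_of_surjective _ Ideal.Quotient.mk_surjective q] at h))
  have : IsArtinianRing (R ⧸ I) := isArtinianRing_iff_isNoetherianRing_krullDimLE_zero.2 ⟨inferInstance, inferInstance⟩
  have ht : Module.IsTorsionBySet R N (I : Set R) := fun n a => h0 a a.2 n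
  letI := ht.module
  haveI : IsScalarTower R (R ⧸ I) N := ht.isScalarTower
  have : Module.Finite (R ⧸ I) N := Module.Finite.of_restrictScalars_finite R _ _
  have : IsArtinian (R ⧸ I) N := inferInstance
  exact isArtinian_of_surjective_algebraMap (S := R) (R := R ⧸ I) Ideal.Quotient.mk_surjective
end

section
variable {N N' : Type} [AddCommGroup N] [Module A N] [AddCommGroup N'] [Module A N']

lemma Tors_inj {I : Ideal A} (f : N →ₗ[A] N') (hf : Function.Injective f) (h : Tors I N') : Tors I N := by
  intro n x hx
  obtain ⟨k, hk⟩ := h (f n) x hx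
  exact ⟨k, hf (by rw [map_smul, hk, map_zero])⟩

lemma Tors_surj {I : Ideal A} (f : N →ₗ[A] N') (hf : Function.Surjective f) (h : Tors I N) : Tors I N' := by
  intro n x hx
  obtain ⟨n, rfl⟩ := hf n
  obtain ⟨k, hk⟩ := h n x hx
  exact ⟨k, by rw [← map_smul, hk, map_zero]⟩

variable [IsNoetherianRing A] {𝔞 𝔟 : Ideal A}

lemma base_case (h : 𝔞 ≤ 𝔟.radical) (hb : ∀ b ∈ 𝔟, ∀ n : N, b • n = 0) (h0 : EF 𝔞 N 0) (i : ℕ) :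
    EF 𝔞 N i := by
  obtain ⟨k, hk⟩ := Ideal.exists_pow_le_of_le_radical_of_fg h (IsNoetherian.noetherian 𝔞)
  have h1 := kill_pow_finite (EF_zero_iff.1 h0) k
  have h2 : kill (𝔞 ^ k) N = ⊤ := by
    rw [eq_top_iff]; intro n _ a ha; exact hb a (hk ha) n
  rw [h2] at h1
  have : Module.Finite A N := Module.Finite.equiv (Submodule.topEquiv (R := A) (M := N))
  exact EF_of_finite i

lemma EF_subtype_zero (K : Submodule A N) (h : EF 𝔞 N 0) : EF 𝔞 K 0 :=
  EF_inj_zero K.injective_subtype h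

lemma exact_ker_range (f : N →ₗ[A] N') :
    Function.Exact (LinearMap.ker f).subtype f.rangeRestrict := by
  intro x
  constructor
  · intro h
    exact ⟨⟨x, congrArg Subtype.val h⟩, rfl⟩
  · rintro ⟨y, rfl⟩
    exact Subtype.ext y.2

lemma mel {y : A} (hy : y ∈ 𝔞) (h1 : ∀ i, EF 𝔞 (LinearMap.ker (LinearMap.lsmul A N y)) i)
    (h2 : ∀ i, EF 𝔞 (N ⧸ LinearMap.range (LinearMap.lsmul A N y)) i) (i : ℕ) : EF 𝔞 N i := by
  set f := LinearMap.lsmul A N y with hf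
  have hf' : f = y • LinearMap.id := by ext; rfl
  have hc : (LinearMap.range f).subtype ∘ₗ f.rangeRestrict = f := by ext; rfl
  have hz : Emap 𝔞 i (LinearMap.range f).subtype ∘ₗ Emap 𝔞 i f.rangeRestrict = 0 := by
    rw [← Emap_comp, hc, hf', Emap_smul_zero 𝔞 i y hy]
  unfold EF
  refine fin_of_ker_zero _ hz (fin_ker_comp _ _ (ker_surj f.surjective_rangeRestrict ?_) ?_)
  · rw [LinearMap.ker_rangeRestrict]; exact h1 i
  · cases i with
    | zero => rw [ker_inj_zero (Submodule.subtype_injective _)]; infer_instance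
    | succ i =>
      refine ker_inj (Submodule.subtype_injective _) ?_
      rw [Submodule.range_subtype]; exact h2 i

lemma lt_sup_span {y : A} (hy : y ∉ 𝔟) : 𝔟 < 𝔟 ⊔ Ideal.span {y} := by
  refine lt_of_le_of_ne le_sup_left (fun h => hy ?_)
  rw [h]; exact Ideal.mem_sup_right (Ideal.mem_span_singleton_self y)

lemma kill_sup_span {y : A} (hb : ∀ b ∈ 𝔟, ∀ n : N, b • n = 0) (hy : ∀ n : N, y • n = 0) :
    ∀ b ∈ 𝔟 ⊔ Ideal.span {y}, ∀ n : N, b • n = 0 := by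
  intro b h n
  obtain ⟨c, hc, d, hd, rfl⟩ := Submodule.mem_sup.1 h
  obtain ⟨e, rfl⟩ := Ideal.mem_span_singleton'.1 hd
  rw [add_smul, hb c hc, mul_smul, hy, smul_zero, add_zero]
end

lemma D0 [IsNoetherianRing A] {𝔞 : Ideal A} (𝔟 : Ideal A) : ∀ (N : Type) [AddCommGroup N] [Module A N],
    (∀ b ∈ 𝔟, ∀ n : N, b • n = 0) → Tors 𝔞 N → IsArtinian A N → EF 𝔞 N 0 → ∀ i, EF 𝔞 N i := by
  induction 𝔟 using WellFoundedGT.induction with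
  | ind 𝔟 IH =>
  intro N _ _ hb ht hA h0 i
  by_cases hr : 𝔞 ≤ 𝔟.radical
  · exact base_case hr hb h0 i
  obtain ⟨y, hy, hyr⟩ := SetLike.not_le_iff_exists.1 hr
  have hyp : ∀ n, y ^ n ∉ 𝔟 := fun n h => hyr ⟨n, h⟩
  obtain ⟨n, hn⟩ := IsArtinian.range_smul_pow_stabilizes N y
  have hK : ∀ i, EF 𝔞 (LinearMap.ker (LinearMap.lsmul A N (y ^ n))) i := by
    refine IH _ (lt_sup_span (hyp n)) _ (kill_sup_span (fun b h m => Subtype.ext (hb b h m)) ?_)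
      (Tors_inj _ (Submodule.subtype_injective _) ht) inferInstance (EF_subtype_zero _ h0)
    intro m; exact Subtype.ext m.2
  set N1 := LinearMap.range (LinearMap.lsmul A N (y ^ n)) with hN1
  have hK1 : ∀ i, EF 𝔞 (LinearMap.ker (LinearMap.lsmul A N1 y)) i := by
    refine IH _ (lt_sup_span (by simpa using hyp 1)) _ (kill_sup_span (fun b h m => Subtype.ext (Subtype.ext (hb b h m))) ?_)
      (Tors_inj _ (Submodule.subtype_injective _) (Tors_inj _ (Submodule.subtype_injective _) ht))
      inferInstance (EF_subtype_zero _ (EF_subtype_zero _ h0))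
    intro m; exact Subtype.ext m.2
  have hE : ∀ i, EF 𝔞 N1 i := by
    refine mel hy hK1 (fun i => ?_)
    have : LinearMap.range (LinearMap.lsmul A N1 y) = ⊤ := by
      rw [LinearMap.range_eq_top]
      rintro ⟨_, m, rfl⟩
      have h1 : y ^ n • m ∈ LinearMap.range (y ^ n • LinearMap.id : N →ₗ[A] N) := ⟨m, rfl⟩
      rw [hn (n + 1) (by simp)] at h1
      obtain ⟨m', hm'⟩ := h1
      refine ⟨⟨y ^ n • m', m', rfl⟩, Subtype.ext ?_⟩
      change y • y ^ n • m' = y ^ n • m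
      rw [← hm', smul_smul, ← pow_succ']; rfl
    have : Subsingleton (N1 ⧸ LinearMap.range (LinearMap.lsmul A N1 y)) :=
      Submodule.Quotient.subsingleton_iff.2 this
    exact EF_of_finite i
  exact EF_mid (Submodule.subtype_injective _) (LinearMap.surjective_rangeRestrict _)
    (exact_ker_range _) (hK i) (hE i)

section
variable {N : Type} [AddCommGroup N] [Module A N] [IsNoetherianRing A] {𝔞 𝔟 : Ideal A}

lemma kill_loc_finite (p : Ideal A) [p.IsPrime] (h0 : Module.Finite A (kill 𝔞 N)) :
    Module.Finite (Localization.AtPrime p)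
      (kill (𝔞.map (algebraMap A (Localization.AtPrime p))) (LocalizedModule p.primeCompl N)) := by
  classical
  obtain ⟨s, hs⟩ := (Module.Finite.iff_fg (N := kill 𝔞 N)).1 h0
  let W : Submodule (Localization.AtPrime p) (LocalizedModule p.primeCompl N) :=
    Submodule.span _ ((s.image (LocalizedModule.mkLinearMap p.primeCompl N) : Finset _) : Set _)
  have : Module.Finite (Localization.AtPrime p) W := Module.Finite.iff_fg.2 ⟨_, rfl⟩
  have hW : ∀ m ∈ kill 𝔞 N, LocalizedModule.mkLinearMap p.primeCompl N m ∈ W := by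
    intro m hm
    rw [← hs] at hm
    induction hm using Submodule.span_induction with
    | mem m hm => exact Submodule.subset_span (by simpa using ⟨m, hm, rfl⟩)
    | zero => simp
    | add a b _ _ ha hb => rw [map_add]; exact add_mem ha hb
    | smul r a _ ha =>
      rw [map_smul, ← algebraMap_smul (Localization.AtPrime p)]
      exact Submodule.smul_mem _ _ ha
  obtain ⟨a, ha⟩ := IsNoetherian.noetherian 𝔞
  have hle : kill (𝔞.map (algebraMap A (Localization.AtPrime p))) (LocalizedModule p.primeCompl N) ≤ W := by
    intro v hv
    induction v using LocalizedModule.induction_on with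
    | h m u =>
    have h1 : ∀ b ∈ a, ∃ w ∈ p.primeCompl, w • b • m = 0 := by
      intro b hb
      have h2 := hv (algebraMap A _ b) (Ideal.mem_map_of_mem _ (ha ▸ Submodule.subset_span hb))
      rw [algebraMap_smul, LocalizedModule.smul'_mk, ← LocalizedModule.zero_mk (1 : p.primeCompl),
        LocalizedModule.mk_eq] at h2
      obtain ⟨w, h⟩ := h2
      exact ⟨w, w.2, by simpa [Submonoid.smul_def] using h⟩
    choose! w hw hw0 using h1
    let T := ∏ b ∈ a, w b
    have hT : T ∈ p.primeCompl := Submonoid.prod_mem _ hw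
    have hk : T • m ∈ kill 𝔞 N := by
      intro c hc
      rw [← ha] at hc
      induction hc using Submodule.span_induction with
      | mem b hb =>
        obtain ⟨d, hd⟩ := Finset.dvd_prod_of_mem w hb
        change b • T • m = 0
        rw [show T = w b * d from hd, mul_comm, smul_comm, mul_smul, hw0 b hb, smul_zero]
      | zero => simp
      | add a b _ _ ha hb => rw [add_smul, ha, hb, add_zero]
      | smul r a _ ha => rw [smul_assoc, ha, smul_zero]
    have h3 := W.smul_mem (Localization.mk 1 (⟨T, hT⟩ * u)) (hW _ hk)
    convert h3 using 1
    rw [LocalizedModule.mkLinearMap_apply, LocalizedModule.mk_smul_mk, LocalizedModule.mk_eq]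
    refine ⟨1, ?_⟩
    simp only [one_smul, mul_one, Submonoid.smul_def, Submonoid.coe_mul, smul_smul]
    congr 1
    ring
  exact Module.Finite.of_injective (Submodule.inclusion hle) (Submodule.inclusion_injective _)

lemma Tors_loc (p : Ideal A) [p.IsPrime] (ht : Tors 𝔞 N) :
    Tors (𝔞.map (algebraMap A (Localization.AtPrime p))) (LocalizedModule p.primeCompl N) := by
  intro v x hx
  have : 𝔞.map (algebraMap A (Localization.AtPrime p)) ≤
      Ideal.radical (LinearMap.ker (LinearMap.toSpanSingleton (Localization.AtPrime p) _ v)) := by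
    rw [Ideal.map_le_iff_le_comap]
    intro a ha
    induction v using LocalizedModule.induction_on with
    | h m u =>
    obtain ⟨k, hk⟩ := ht m a ha
    refine ⟨k, ?_⟩
    rw [LinearMap.mem_ker, LinearMap.toSpanSingleton_apply, ← map_pow, algebraMap_smul,
      LocalizedModule.smul'_mk, hk, LocalizedModule.zero_mk]
  obtain ⟨k, hk⟩ := this hx
  exact ⟨k, hk⟩

lemma artin_loc (p : Ideal A) [hp : p.IsPrime] (hm : p ∈ (𝔞 ⊔ 𝔟).minimalPrimes)
    (hb : ∀ b ∈ 𝔟, ∀ n : N, b • n = 0) (ht : Tors 𝔞 N) (h0 : Module.Finite A (kill 𝔞 N)) :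
    IsArtinian (Localization.AtPrime p) (LocalizedModule p.primeCompl N) := by
  refine artin_kill (Tors_loc p ht) ?_
  have := kill_loc_finite p h0
  refine artin_of_ann (I := (𝔞 ⊔ 𝔟).map (algebraMap A (Localization.AtPrime p))) ?_ ?_
  · intro a ha n
    rw [Ideal.map_sup] at ha
    obtain ⟨c, hc, d, hd, rfl⟩ := Submodule.mem_sup.1 ha
    have h1 : c • n = 0 := Subtype.ext (n.2 c hc)
    have h2 : d • n = 0 := by
      have : 𝔟.map (algebraMap A (Localization.AtPrime p)) ≤
        (LinearMap.ker (LinearMap.toSpanSingleton (Localization.AtPrime p) _ n)) := by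
        rw [Ideal.map_le_iff_le_comap]
        intro b hbb
        rw [Ideal.mem_comap, LinearMap.mem_ker, LinearMap.toSpanSingleton_apply, algebraMap_smul]
        obtain ⟨v, hv⟩ := n
        apply Subtype.ext
        change b • v = 0
        induction v using LocalizedModule.induction_on with
        | h m u =>
        rw [LocalizedModule.smul'_mk, hb b hbb, LocalizedModule.zero_mk]
      exact this hd
    rw [add_smul, h1, h2, add_zero]
  · intro q hq hle
    have hc : q.comap (algebraMap A (Localization.AtPrime p)) = p := by
      have hqp : q.comap (algebraMap A (Localization.AtPrime p)) ≤ p := by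
        have := Ideal.comap_mono (f := algebraMap A (Localization.AtPrime p))
          (IsLocalRing.le_maximalIdeal hq.ne_top)
        exact this.trans (le_of_eq Localization.AtPrime.comap_maximalIdeal)
      exact le_antisymm hqp (hm.2 ⟨hq.comap _, Ideal.map_le_iff_le_comap.1 hle⟩ hqp)
    have : q = IsLocalRing.maximalIdeal (Localization.AtPrime p) := by
      rw [← IsLocalization.map_comap p.primeCompl _ q, show Ideal.under A q = p from hc,
        Localization.AtPrime.map_eq_maximalIdeal]
    rw [this]; infer_instance

lemma stab (y : A) (p : Ideal A) (hm : p ∈ (𝔞 ⊔ 𝔟).minimalPrimes)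
    (hb : ∀ b ∈ 𝔟, ∀ n : N, b • n = 0) (ht : Tors 𝔞 N) (h0 : Module.Finite A (kill 𝔞 N)) :
    ∃ n, ∀ k, n ≤ k → ∀ m : N, ∃ s ∉ p, ∃ m' : N, s • y ^ k • m = y ^ (k + 1) • m' := by
  have hp : p.IsPrime := hm.1.1
  have := artin_loc p hm hb ht h0
  obtain ⟨n, hn⟩ := IsArtinian.range_smul_pow_stabilizes (LocalizedModule p.primeCompl N)
    (algebraMap A (Localization.AtPrime p) y)
  refine ⟨n, fun k hk m => ?_⟩
  have h1 := (hn k hk).symm.trans (hn (k + 1) (by omega))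
  have h2 : (algebraMap A (Localization.AtPrime p) y) ^ k • LocalizedModule.mk m 1 ∈
    LinearMap.range ((algebraMap A (Localization.AtPrime p) y) ^ (k + 1) • (LinearMap.id :
      LocalizedModule p.primeCompl N →ₗ[Localization.AtPrime p] _)) := by
    rw [← h1]; exact ⟨_, rfl⟩
  obtain ⟨v, hv⟩ := h2
  induction v using LocalizedModule.induction_on with
  | h m' u =>
  simp only [LinearMap.smul_apply, LinearMap.id_apply, ← map_pow, algebraMap_smul,
    LocalizedModule.smul'_mk] at hv
  rw [LocalizedModule.mk_eq] at hv
  obtain ⟨w, hw⟩ := hv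
  refine ⟨w * u, (w * u).2, (w : A) • m', ?_⟩
  simp only [one_smul, Submonoid.smul_def, Submonoid.coe_mul] at hw ⊢
  rw [mul_smul, ← hw, smul_comm]
end

lemma artin_Q [IsNoetherianRing A] {𝔞 𝔟 : Ideal A} {Q : Type} [AddCommGroup Q] [Module A Q]
    (hD : ∀ p q r : Ideal A, p.IsPrime → q.IsPrime → r.IsPrime → 𝔞 ⊔ 𝔟 ≤ p → p < q → q < r → False)
    (hb : ∀ b ∈ 𝔟, ∀ n : Q, b • n = 0) (ht : Tors 𝔞 Q) (h0 : Module.Finite A (kill 𝔞 Q))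
    (hs : ∀ p ∈ (𝔞 ⊔ 𝔟).minimalPrimes, ∀ v : Q, ∃ s ∉ p, s • v = 0) : IsArtinian A Q := by
  classical
  refine artin_kill ht ?_
  refine artin_of_ann (I := Module.annihilator A (kill 𝔞 Q))
    (fun a ha n => Module.mem_annihilator.1 ha n) ?_
  intro q hq hle
  have hc : 𝔞 ⊔ 𝔟 ≤ Module.annihilator A (kill 𝔞 Q) := by
    refine sup_le (fun a ha => ?_) (fun b hbb => ?_)
    · rw [Module.mem_annihilator]; intro n; exact Subtype.ext (n.2 a ha)
    · rw [Module.mem_annihilator]; intro n; exact Subtype.ext (hb b hbb n)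
  obtain ⟨p, hp, hpq⟩ := Ideal.exists_minimalPrimes_le (hc.trans hle)
  have hpp : p.IsPrime := hp.1.1
  have hlt : p < q := by
    refine lt_of_le_of_ne hpq ?_
    rintro rfl
    obtain ⟨g, hg⟩ := h0
    choose s hsp hs0 using fun v : Q => hs p hp v
    let T := ∏ v ∈ g, s v
    have hT : T ∈ p.primeCompl := Submonoid.prod_mem _ (fun v _ => hsp v)
    refine hT (hle ?_)
    rw [Module.mem_annihilator]
    intro n
    have hn : n ∈ (⊤ : Submodule A (kill 𝔞 Q)) := trivial
    rw [← hg] at hn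
    induction hn using Submodule.span_induction with
    | mem v hv =>
      obtain ⟨d, hd⟩ := Finset.dvd_prod_of_mem (fun v : kill 𝔞 Q => s v) hv
      rw [show T = s v * d from hd, mul_comm, mul_smul]
      have : s v.1 • v = 0 := Subtype.ext (hs0 _)
      rw [this, smul_zero]
    | zero => simp
    | add a b _ _ ha hb => rw [smul_add, ha, hb, add_zero]
    | smul r a _ ha => rw [smul_comm, ha, smul_zero]
  obtain ⟨r, hr, hqr⟩ := Ideal.exists_le_maximal q hq.ne_top
  rcases eq_or_lt_of_le hqr with rfl | h
  · exact hr
  · exact (hD p q r hpp hq hr.isPrime hp.1.2 hlt h).elim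

lemma Thm1 [IsNoetherianRing A] {𝔞 : Ideal A} (𝔟 : Ideal A) :
    ∀ (N : Type) [AddCommGroup N] [Module A N],
    (∀ p q r : Ideal A, p.IsPrime → q.IsPrime → r.IsPrime → 𝔞 ⊔ 𝔟 ≤ p → p < q → q < r → False) →
    (∀ b ∈ 𝔟, ∀ n : N, b • n = 0) → Tors 𝔞 N → EF 𝔞 N 0 → EF 𝔞 N 1 → ∀ i, EF 𝔞 N i := by
  induction 𝔟 using WellFoundedGT.induction with
  | ind 𝔟 IH =>
  intro N _ _ hD hb ht h0 h1 i
  by_cases hr : 𝔞 ≤ 𝔟.radical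
  · exact base_case hr hb h0 i
  obtain ⟨y, hy, hyr⟩ := SetLike.not_le_iff_exists.1 hr
  have hyp : ∀ n, y ^ n ∉ 𝔟 := fun n h => hyr ⟨n, h⟩
  have hD' : ∀ 𝔟' : Ideal A, 𝔟 < 𝔟' → ∀ p q r : Ideal A, p.IsPrime → q.IsPrime → r.IsPrime →
      𝔞 ⊔ 𝔟' ≤ p → p < q → q < r → False := fun 𝔟' h p q r hp hq hr hle =>
    hD p q r hp hq hr ((sup_le_sup_left h.le _).trans hle)
  obtain ⟨n, hn⟩ : ∃ n, ∀ p ∈ (𝔞 ⊔ 𝔟).minimalPrimes, ∀ m : N, ∃ s ∉ p, ∃ m' : N,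
      s • y ^ n • m = y ^ (n + 1) • m' := by
    have hfin := (𝔞 ⊔ 𝔟).finite_minimalPrimes_of_isNoetherianRing
    have h2 := fun p hp => stab (N := N) (𝔞 := 𝔞) (𝔟 := 𝔟) y p hp hb ht (EF_zero_iff.1 h0)
    choose! F hF using h2
    refine ⟨hfin.toFinset.sup F, fun p hp m => hF p hp _ ?_ m⟩
    exact Finset.le_sup (f := F) (hfin.mem_toFinset.2 hp)
  set f := LinearMap.lsmul A N (y ^ n) with hf
  have hexf := exact_ker_range f
  have hN10 : EF 𝔞 (LinearMap.range f) 0 := EF_subtype_zero _ h0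
  have hK : ∀ i, EF 𝔞 (LinearMap.ker f) i := by
    refine IH _ (lt_sup_span (hyp n)) _ (hD' _ (lt_sup_span (hyp n)))
      (kill_sup_span (fun b h m => Subtype.ext (hb b h m)) ?_)
      (Tors_inj _ (Submodule.subtype_injective _) ht) (EF_subtype_zero _ h0) ?_
    · intro m; exact Subtype.ext m.2
    · exact EF_left (Submodule.subtype_injective _) (LinearMap.surjective_rangeRestrict _) hexf hN10 h1
  have hN11 : EF 𝔞 (LinearMap.range f) 1 :=
    EF_right (Submodule.subtype_injective _) (LinearMap.surjective_rangeRestrict _) hexf h1 (hK 2)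
  have htN1 : Tors 𝔞 (LinearMap.range f) := Tors_inj _ (Submodule.subtype_injective _) ht
  have hbN1 : ∀ b ∈ 𝔟, ∀ m : LinearMap.range f, b • m = 0 := fun b h m => Subtype.ext (hb b h m)
  have hsN1 : ∀ p ∈ (𝔞 ⊔ 𝔟).minimalPrimes, ∀ m : LinearMap.range f, ∃ s ∉ p,
      ∃ m' : LinearMap.range f, s • m = y • m' := by
    rintro p hp ⟨_, m, rfl⟩
    obtain ⟨s, hs, m', h⟩ := hn p hp m
    refine ⟨s, hs, ⟨_, m', rfl⟩, Subtype.ext ?_⟩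
    change s • y ^ n • m = y • y ^ n • m'
    rw [h, smul_smul, ← pow_succ']
  refine EF_mid (Submodule.subtype_injective _) (LinearMap.surjective_rangeRestrict _) hexf (hK i) ?_
  clear hexf hf hn hK
  clear_value f
  generalize LinearMap.range f = N1 at *
  set g := LinearMap.lsmul A N1 y with hg
  have hexg := exact_ker_range g
  have hy1 : y ∉ 𝔟 := by simpa using hyp 1
  have hN20 : EF 𝔞 (LinearMap.range g) 0 := EF_subtype_zero _ hN10
  have hK1 : ∀ i, EF 𝔞 (LinearMap.ker g) i := by
    refine IH _ (lt_sup_span hy1) _ (hD' _ (lt_sup_span hy1))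
      (kill_sup_span (fun b h m => Subtype.ext (hbN1 b h m)) ?_)
      (Tors_inj _ (Submodule.subtype_injective _) htN1) (EF_subtype_zero _ hN10) ?_
    · intro m; exact Subtype.ext m.2
    · exact EF_left (Submodule.subtype_injective _) (LinearMap.surjective_rangeRestrict _) hexg hN20 hN11
  have hN21 : EF 𝔞 (LinearMap.range g) 1 :=
    EF_right (Submodule.subtype_injective _) (LinearMap.surjective_rangeRestrict _) hexg hN11 (hK1 2)
  have hQ0 : EF 𝔞 (N1 ⧸ LinearMap.range g) 0 :=
    EF_right (Submodule.subtype_injective _) (Submodule.mkQ_surjective (LinearMap.range g))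
      (by intro x; simp) hN10 hN21
  have htQ : Tors 𝔞 (N1 ⧸ LinearMap.range g) := Tors_surj _ (Submodule.mkQ_surjective _) htN1
  have hbQ : ∀ b ∈ 𝔟, ∀ m : N1 ⧸ LinearMap.range g, b • m = 0 := by
    intro b h m
    obtain ⟨m, rfl⟩ := Submodule.mkQ_surjective _ m
    rw [← map_smul, hbN1 b h, map_zero]
  have hQA : IsArtinian A (N1 ⧸ LinearMap.range g) := by
    refine artin_Q hD hbQ htQ (EF_zero_iff.1 hQ0) (fun p hp v => ?_)
    obtain ⟨m, rfl⟩ := Submodule.mkQ_surjective _ v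
    obtain ⟨s, hs, m', h⟩ := hsN1 p hp m
    refine ⟨s, hs, ?_⟩
    rw [← map_smul, h]
    exact (Submodule.Quotient.mk_eq_zero _).2 ⟨m', rfl⟩
  exact mel hy hK1 (D0 𝔟 _ hbQ htQ hQA hQ0) i

lemma tors_of_support {𝔞 : Ideal A} {M : Type} [AddCommGroup M] [Module A M]
    (h : Module.support A M ⊆ PrimeSpectrum.zeroLocus (𝔞 : Set A)) : Tors 𝔞 M := by
  intro m x hx
  have : x ∈ (Submodule.span A {m}).annihilator.radical := by
    rw [Ideal.radical_eq_sInf, Ideal.mem_sInf]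
    rintro p ⟨hp, hpp⟩
    exact h (Module.mem_support_iff_exists_annihilator (p := (⟨p, hpp⟩ : PrimeSpectrum A)).2
      ⟨m, hp⟩) hx
  obtain ⟨k, hk⟩ := this
  exact ⟨k, (Submodule.mem_annihilator_span_singleton _ _).1 hk⟩

lemma D1_of_dim {𝔞 : Ideal A} (h : ringKrullDim (A ⧸ 𝔞) = 1) (p q r : Ideal A) (hp : p.IsPrime)
    (hq : q.IsPrime) (hr : r.IsPrime) (hle : 𝔞 ≤ p) (h1 : p < q) (h2 : q < r) : False := by
  rw [ringKrullDim_quotient] at h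
  let P : PrimeSpectrum.zeroLocus (𝔞 : Set A) := ⟨⟨p, hp⟩, hle⟩
  let Q : PrimeSpectrum.zeroLocus (𝔞 : Set A) := ⟨⟨q, hq⟩, hle.trans h1.le⟩
  let R : PrimeSpectrum.zeroLocus (𝔞 : Set A) := ⟨⟨r, hr⟩, hle.trans (h1.le.trans h2.le)⟩
  have hPQ : P < Q := h1
  have hQR : Q < R := h2
  let L : LTSeries (PrimeSpectrum.zeroLocus (𝔞 : Set A)) :=
    { length := 2
      toFun := ![P, Q, R]
      step := by intro i; fin_cases i <;> assumption }
  have := Order.LTSeries.length_le_krullDim L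
  rw [h] at this
  have h3 : L.length = 2 := rfl
  rw [h3] at this
  exact absurd this (by decide)

lemma min_of_dim (h : ringKrullDim A ≤ 2) (o p q r : Ideal A) (ho : o.IsPrime) (hp : p.IsPrime)
    (hq : q.IsPrime) (hr : r.IsPrime) (h0 : o < p) (h1 : p < q) (h2 : q < r) : False := by
  let O : PrimeSpectrum A := ⟨o, ho⟩
  let P : PrimeSpectrum A := ⟨p, hp⟩
  let Q : PrimeSpectrum A := ⟨q, hq⟩
  let R : PrimeSpectrum A := ⟨r, hr⟩
  have hOP : O < P := h0
  have hPQ : P < Q := h1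
  have hQR : Q < R := h2
  let L : LTSeries (PrimeSpectrum A) :=
    { length := 3
      toFun := ![O, P, Q, R]
      step := by intro i; fin_cases i <;> assumption }
  have := (Order.LTSeries.length_le_krullDim L).trans h
  have h3 : L.length = 3 := rfl
  rw [h3] at this
  exact absurd this (by decide)

lemma exists_kill_pow [IsNoetherianRing A] {𝔞 p : Ideal A} (hp : p.IsPrime) (hle : 𝔞 ≤ p)
    (hmin : ∀ q : Ideal A, q.IsPrime → q ≤ p → q = p) : ∃ s ∉ p, ∃ k, s ∈ kill (𝔞 ^ k) A := by
  classical
  have h1 : 𝔞 ≤ (RingHom.ker (algebraMap A (Localization.AtPrime p))).radical := by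
    intro a ha
    have : IsNilpotent (algebraMap A (Localization.AtPrime p) a) := by
      rw [nilpotent_iff_mem_prime]
      intro q hq
      have hqp : q.comap (algebraMap A (Localization.AtPrime p)) ≤ p := by
        have := Ideal.comap_mono (f := algebraMap A (Localization.AtPrime p))
          (IsLocalRing.le_maximalIdeal hq.ne_top)
        exact this.trans (le_of_eq Localization.AtPrime.comap_maximalIdeal)
      have := hle ha
      rw [← hmin _ (hq.comap _) hqp] at this
      exact this
    obtain ⟨k, hk⟩ := this
    exact ⟨k, by rw [RingHom.mem_ker, map_pow, hk]⟩
  obtain ⟨k, hk⟩ := Ideal.exists_pow_le_of_le_radical_of_fg h1 (IsNoetherian.noetherian 𝔞)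
  obtain ⟨g, hg⟩ := IsNoetherian.noetherian (𝔞 ^ k)
  have h2 : ∀ a ∈ g, ∃ s ∈ p.primeCompl, s * a = 0 := by
    intro a ha
    have := hk (hg ▸ Submodule.subset_span ha : a ∈ 𝔞 ^ k)
    rw [RingHom.mem_ker, IsLocalization.map_eq_zero_iff p.primeCompl] at this
    obtain ⟨m, hm⟩ := this
    exact ⟨m, m.2, hm⟩
  choose! s hs hs0 using h2
  have hT : ∏ a ∈ g, s a ∈ p.primeCompl := Submonoid.prod_mem _ hs
  refine ⟨_, hT, k, ?_⟩
  intro c hc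
  rw [← hg] at hc
  induction hc using Submodule.span_induction with
  | mem b hb =>
    obtain ⟨d, hd⟩ := Finset.dvd_prod_of_mem s hb
    rw [hd, smul_eq_mul, ← mul_assoc, mul_comm b, hs0 b hb, zero_mul]
  | zero => simp
  | add a b _ _ ha hb => rw [add_smul, ha, hb, add_zero]
  | smul r a _ ha => rw [smul_assoc, ha, smul_zero]

lemma Thm2 [IsNoetherianRing A] {𝔞 : Ideal A} {M : Type} [AddCommGroup M] [Module A M]
    (hdim : ringKrullDim A ≤ 2) (ht : Tors 𝔞 M) (h0 : EF 𝔞 M 0) (h1 : EF 𝔞 M 1) (i : ℕ) :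
    EF 𝔞 M i := by
  obtain ⟨n, hn⟩ := monotone_stabilizes_iff_noetherian.2 (inferInstanceAs (IsNoetherian A A))
    ⟨fun k => kill (𝔞 ^ k) A, fun a b hab x hx c hc => hx c (Ideal.pow_le_pow_right hab hc)⟩
  let 𝔟 : Ideal A := kill (𝔞 ^ n) A
  have hD : ∀ p q r : Ideal A, p.IsPrime → q.IsPrime → r.IsPrime → 𝔞 ⊔ 𝔟 ≤ p → p < q → q < r →
      False := by
    intro p q r hp hq hr hle hpq hqr
    have hmin : ∀ o : Ideal A, o.IsPrime → o ≤ p → o = p := fun o ho hop => by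
      by_contra hne
      exact min_of_dim hdim o p q r ho hp hq hr (lt_of_le_of_ne hop hne) hpq hqr
    obtain ⟨s, hs, k, hk⟩ := exists_kill_pow hp (le_sup_left.trans hle) hmin
    apply hs
    apply hle
    apply Ideal.mem_sup_right
    rcases le_total k n with h | h
    · exact fun c hc => hk c (Ideal.pow_le_pow_right h hc)
    · have := hn k h
      change 𝔟 = kill (𝔞 ^ k) A at this
      rw [this]; exact hk
  let N := kill 𝔟 M
  obtain ⟨g, hg⟩ := IsNoetherian.noetherian 𝔟
  have hfin := kill_pow_finite (EF_zero_iff.1 h0) n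
  let φ : M →ₗ[A] ({b // b ∈ g} → kill (𝔞 ^ n) M) := LinearMap.pi fun b =>
    (LinearMap.lsmul A M b.1).codRestrict _ (fun m a ha => by
      have hb : b.1 ∈ 𝔟 := hg ▸ Submodule.subset_span b.2
      have : a * b.1 = 0 := hb a ha
      rw [LinearMap.lsmul_apply, smul_smul, this, zero_smul])
  have hker : LinearMap.ker φ = N := by
    ext m
    constructor
    · intro hm c hc
      rw [← hg] at hc
      induction hc using Submodule.span_induction with
      | mem b hb => exact congrArg Subtype.val (congrFun hm ⟨b, hb⟩)
      | zero => simp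
      | add a b _ _ ha hb => rw [add_smul, ha, hb, add_zero]
      | smul r a _ ha => rw [smul_assoc, ha, smul_zero]
    · intro hm
      funext b
      exact Subtype.ext (hm b.1 (hg ▸ Submodule.subset_span b.2))
  have hR : Module.Finite A (LinearMap.range φ) := inferInstance
  have hex := exact_ker_range φ
  have hK : ∀ i, EF 𝔞 (LinearMap.ker φ) i := by
    refine Thm1 𝔟 _ hD ?_ (Tors_inj _ (Submodule.subtype_injective _) ht) (EF_subtype_zero _ h0) ?_
    · intro b hb m
      have : m.1 ∈ N := hker ▸ m.2
      exact Subtype.ext (this b hb)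
    · exact EF_left (Submodule.subtype_injective _) (LinearMap.surjective_rangeRestrict _) hex
        (EF_of_finite 0) h1
  exact EF_mid (Submodule.subtype_injective _) (LinearMap.surjective_rangeRestrict _) hex (hK i)
    (EF_of_finite i)

section
variable {t : ℕ} (x : Fin t → A) (M : Type) [AddCommGroup M] [Module A M]

lemma koszul_zero (c : KoszulCochain x M 0) (s : {s : Finset (Fin t) // s.card = 0 + 1}) :
    koszulD x M 0 c s = (∑ j ∈ s.1, x j) • c ⟨∅, rfl⟩ := by
  rw [koszulD, LinearMap.pi_apply, LinearMap.sum_apply]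
  have : ∀ (j : {j // j ∈ s.1}), (((((-1 : A) ^ ((s.1.filter (fun k => k < j.1)).card)) * x j.1) •
      (LinearMap.proj
        (⟨s.1.erase j.1, by simp [Finset.card_erase_of_mem j.2, s.2]⟩ :
          {s : Finset (Fin t) // s.card = 0}) :
        KoszulCochain x M 0 →ₗ[A] M))) c = x j.1 • c ⟨∅, rfl⟩ := by
    intro j
    have h1 : s.1.erase j.1 = ∅ := by
      rw [← Finset.card_eq_zero]; simp [Finset.card_erase_of_mem j.2, s.2]
    have h2 : s.1.filter (fun k => k < j.1) = ∅ := by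
      rw [Finset.eq_empty_iff_forall_notMem]
      intro k hk
      rw [Finset.mem_filter] at hk
      have : k ∈ s.1.erase j.1 := Finset.mem_erase.2 ⟨hk.2.ne, hk.1⟩
      rw [h1] at this; simp at this
    rw [LinearMap.smul_apply, LinearMap.proj_apply, h2]
    simp [h1]
  rw [Finset.sum_congr rfl (fun j _ => this j), ← Finset.sum_smul, Finset.sum_attach s.1 x]

lemma koszul_comp (c : KoszulCochain x M 0) : koszulD x M 1 (koszulD x M 0 c) = 0 := by
  funext s
  rw [koszulD, LinearMap.pi_apply, LinearMap.sum_apply]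
  simp only [LinearMap.smul_apply, LinearMap.proj_apply]
  have := koszul_zero x M c
  simp only [this]
  rw [Finset.sum_attach s.1 (fun j => ((-1 : A) ^ ((s.1.filter (fun k => k < j)).card) * x j) •
    (∑ k ∈ s.1.erase j, x k) • c ⟨∅, rfl⟩)]
  obtain ⟨s, hs⟩ := s
  obtain ⟨a, b, hab, rfl⟩ := Finset.card_eq_two.1 hs
  have key : ∀ a b : Fin t, a < b → ∑ j ∈ ({a, b} : Finset (Fin t)),
    ((-1 : A) ^ ((({a, b} : Finset (Fin t)).filter (fun k => k < j)).card) * x j) •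
    (∑ k ∈ ({a, b} : Finset (Fin t)).erase j, x k) • c ⟨∅, rfl⟩ = 0 := by
    intro a b hab
    rw [Finset.sum_pair hab.ne]
    have e1 : ({a, b} : Finset (Fin t)).erase a = {b} := by
      ext k; simp only [Finset.mem_erase, Finset.mem_insert, Finset.mem_singleton]; constructor
      · rintro ⟨h, rfl | rfl⟩ <;> simp_all
      · rintro rfl; exact ⟨hab.ne', Or.inr rfl⟩
    have e2 : ({a, b} : Finset (Fin t)).erase b = {a} := by
      ext k; simp only [Finset.mem_erase, Finset.mem_insert, Finset.mem_singleton]; constructor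
      · rintro ⟨h, rfl | rfl⟩ <;> simp_all
      · rintro rfl; exact ⟨hab.ne, Or.inl rfl⟩
    have e3 : ({a, b} : Finset (Fin t)).filter (fun k => k < a) = ∅ := by
      simp [Finset.filter_insert, Finset.filter_singleton, hab.le]
    have e4 : ({a, b} : Finset (Fin t)).filter (fun k => k < b) = {a} := by
      simp [Finset.filter_insert, Finset.filter_singleton, hab]
    rw [e1, e2, e3, e4]
    simp only [Finset.sum_singleton, Finset.card_empty, Finset.card_singleton, smul_smul, ← add_smul]
    ring_nf
    simp
  rcases lt_or_gt_of_ne hab with h | h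
  · exact key a b h
  · simp only [Finset.pair_comm a b]; exact key b a h

lemma Emap_koszul {𝔞 : Ideal A} (hx : ∀ j, x j ∈ 𝔞) (i j : ℕ) : Emap 𝔞 j (koszulD x M i) = 0 := by
  classical
  have h1 : koszulD x M i = ∑ s, LinearMap.single A (fun _ => M) s ∘ₗ
      (LinearMap.proj s ∘ₗ koszulD x M i) := by
    ext; simp
  change EmapL 𝔞 j _ = 0
  rw [h1, map_sum]
  refine Finset.sum_eq_zero fun s _ => ?_
  change Emap 𝔞 j _ = 0
  rw [Emap_comp, koszulD, LinearMap.proj_pi]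
  have : EmapL 𝔞 j (∑ j ∈ s.1.attach,
    (((-1 : A) ^ ((s.1.filter (fun k => k < j.1)).card)) * x j.1) •
      (LinearMap.proj
        (⟨s.1.erase j.1, by simp [Finset.card_erase_of_mem j.2, s.2]⟩ :
          {s : Finset (Fin t) // s.card = i}) :
        KoszulCochain x M i →ₗ[A] M)) = 0 := by
    rw [map_sum]
    refine Finset.sum_eq_zero fun k _ => ?_
    exact Emap_smul_zero 𝔞 j _ (Ideal.mul_mem_left _ _ (hx _)) _
  exact (congrArg (fun z => Emap 𝔞 j _ ∘ₗ z) this).trans (LinearMap.comp_zero _)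

lemma koszul_step [IsNoetherianRing A] {𝔞 : Ideal A} (hx : ∀ j, x j ∈ 𝔞)
    (H : ∀ i ≤ 1, ∀ j ≤ 1, EF 𝔞 (KoszulCohomology x M j) i) : EF 𝔞 M 0 ∧ EF 𝔞 M 1 := by
  let eC : KoszulCochain x M 0 ≃ₗ[A] M :=
    haveI : Unique {s : Finset (Fin t) // s.card = 0} :=
      ⟨⟨⟨∅, rfl⟩⟩, fun s => Subtype.ext (Finset.card_eq_zero.1 s.2)⟩
    LinearEquiv.funUnique _ A M
  have hk : ∀ i ≤ 1, EF 𝔞 (LinearMap.ker (koszulD x M 0)) i := by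
    intro i hi
    refine EF_equiv (Submodule.quotEquivOfEqBot _ ?_) (H i hi 0 (by simp))
    rw [eq_bot_iff]
    intro v hv
    exact Subtype.ext hv
  let Z := LinearMap.ker (koszulD x M 1)
  let d : KoszulCochain x M 0 →ₗ[A] Z := (koszulD x M 0).codRestrict _ (koszul_comp x M)
  have hd : Z.subtype ∘ₗ (LinearMap.range d).subtype ∘ₗ d.rangeRestrict = koszulD x M 0 := by
    ext; rfl
  have hz : ∀ i, (Emap 𝔞 i Z.subtype ∘ₗ Emap 𝔞 i (LinearMap.range d).subtype ∘ₗ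
      Emap 𝔞 (N := KoszulCochain x M 0) (N' := LinearMap.range d) i d.rangeRestrict) = 0 := by
    intro i
    rw [← Emap_comp, ← Emap_comp, hd, Emap_koszul x M hx]
  have hdk : LinearMap.ker d.rangeRestrict = LinearMap.ker (koszulD x M 0) := by
    rw [LinearMap.ker_rangeRestrict]; exact LinearMap.ker_codRestrict _ _ _
  have hM0 : EF 𝔞 M 0 := by
    refine EF_equiv eC ?_
    unfold EF
    refine fin_of_ker_zero _ (hz 0) (fin_ker_comp _ _ (fin_ker_comp _ _
      (ker_surj d.surjective_rangeRestrict (hdk ▸ hk 0 (by simp))) ?_) ?_)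
    · rw [ker_inj_zero (Submodule.subtype_injective _)]; infer_instance
    · rw [ker_inj_zero (Submodule.subtype_injective _)]; infer_instance
  refine ⟨hM0, EF_equiv eC ?_⟩
  unfold EF
  refine fin_of_ker_zero _ (hz 1) (fin_ker_comp _ _ (fin_ker_comp _ _
    (ker_surj d.surjective_rangeRestrict (hdk ▸ hk 1 le_rfl)) ?_) ?_)
  · refine ker_inj (Submodule.subtype_injective _) ?_
    rw [Submodule.range_subtype]
    refine EF_equiv (Submodule.quotEquivOfEq _ _ ?_) (H 0 (by simp) 1 le_rfl)
    ext v
    constructor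
    · rintro ⟨c, hc⟩; exact ⟨c, Subtype.ext hc⟩
    · rintro ⟨c, hc⟩; exact ⟨c, congrArg Subtype.val hc⟩
  · refine ker_inj (Submodule.subtype_injective _) ?_
    rw [Submodule.range_subtype]
    have h2 : EF 𝔞 (KoszulCochain x M 2) 0 := EF_pi hM0
    exact EF_equiv (koszulD x M 1).quotKerEquivRange.symm (EF_subtype_zero _ h2)
end

/-- If `dim A/𝔞 = 1` (or `dim A ≤ 2`), `x₁, …, x_t ∈ 𝔞`, `Supp M ⊆ V(𝔞)`, and
`Hom_A(A/𝔞, H^j(x,M))`, `Ext_A^1(A/𝔞, H^j(x,M))` are finitely generated for `j = 0, 1`,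
then `M` is `𝔞`-cofinite. -/
theorem stmt6 [IsNoetherianRing A] (𝔞 : Ideal A)
    (hdim : ringKrullDim (A ⧸ 𝔞) = 1 ∨ ringKrullDim A ≤ 2)
    {t : ℕ} (x : Fin t → A) (hx : ∀ j, x j ∈ 𝔞)
    (M : Type) [AddCommGroup M] [Module A M]
    (hsupp : Module.support A M ⊆ PrimeSpectrum.zeroLocus (𝔞 : Set A))
    (H : ∀ i ≤ 1, ∀ j ≤ 1, Module.Finite A (extQuot 𝔞 (KoszulCohomology x M j) i)) :
    IsCofinite 𝔞 M := by
  have ht := tors_of_support hsupp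
  obtain ⟨h0, h1⟩ := koszul_step x M hx (fun i hi j hj => (extQuot_iff 𝔞 _ i).1 (H i hi j hj))
  refine ⟨hsupp, fun i => (extQuot_iff 𝔞 M i).2 ?_⟩
  rcases hdim with hd | hd
  · refine Thm1 (⊥ : Ideal A) M ?_ ?_ ht h0 h1 i
    · intro p q r hp hq hr hle
      exact D1_of_dim hd p q r hp hq hr (le_sup_left.trans hle)
    · intro b hb n
      rw [Ideal.mem_bot.1 hb, zero_smul]
  · exact Thm2 hd ht h0 h1 i

end
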